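/- arXiv:1305.2220 — 2 statements merged into one kernel-verified Lean document; each statement's English description precedes it below -/
import Mathlib

section
/- Let P, Q, R, R' be points in the Euclidean plane ℝ². Then the symmetric difference of the closed triangles conv{P,Q,R} and conv{P,Q,R'} is contained in the union conv{P,R,R'} ∪ conv{Q,R,R'}. -/
theorem mem_convexHull_triple_iff {E : Type*} [AddCommGroup E] [Module ℝ E] {P Q R X : E} :
    X ∈ convexHull ℝ {P, Q, R} ↔ ∃ a b c : ℝ, 0 ≤ a ∧ 0 ≤ b ∧ 0 ≤ c ∧ a + b + c = 1 ∧
      a • P + b • Q + c • R = X := by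
  constructor
  · rw [convexHull_insert (Set.insert_nonempty _ _), convexHull_pair, mem_convexJoin]
    rintro ⟨_, rfl, _, ⟨b, c, hb, hc, hbc, rfl⟩, u, v, hu, hv, huv, rfl⟩
    exact ⟨u, v * b, v * c, hu, mul_nonneg hv hb, mul_nonneg hv hc,
      by linear_combination huv + v * hbc, by module⟩
  · rintro ⟨a, b, c, ha, hb, hc, habc, rfl⟩
    have h := (convex_convexHull ℝ {P, Q, R}).sum_mem (t := Finset.univ)
      (w := ![a, b, c]) (z := ![P, Q, R]) (by simp [Fin.forall_fin_succ, ha, hb, hc])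
      (by simpa [Fin.sum_univ_three] using habc)
      (fun i _ ↦ subset_convexHull ℝ _ (by fin_cases i <;> simp))
    simpa [Fin.sum_univ_three] using h

/-- Moving a nonnegative vector along a direction with a negative coordinate, one can stop when
the vector is still nonnegative but has a vanishing coordinate. -/
theorem exists_nonneg_add_mul_and_eq_zero {ι : Type*} [Fintype ι] {a w : ι → ℝ}
    (ha : ∀ i, 0 ≤ a i) (hw : ∃ i, w i < 0) :
    ∃ t : ℝ, 0 ≤ t ∧ (∀ i, 0 ≤ a i + t * w i) ∧ ∃ i, a i + t * w i = 0 := by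
  classical
  obtain ⟨j, hj, hmin⟩ := Finset.exists_min_image (Finset.univ.filter (w · < 0))
    (fun i ↦ a i / -w i) (by simpa [Finset.Nonempty] using hw)
  have hj : w j < 0 := by simpa using hj
  have ht : 0 ≤ a j / -w j := div_nonneg (ha j) (by linarith)
  refine ⟨a j / -w j, ht, fun i ↦ ?_, j, ?_⟩
  · rcases lt_or_ge (w i) 0 with hi | hi
    · have := hmin i (by simpa using hi)
      rw [le_div_iff₀ (by linarith)] at this
      linarith
    · exact add_nonneg (ha i) (mul_nonneg ht hi)
  · field_simp [hj.ne]
    simp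

/-- Four points in the plane satisfy a nontrivial affine relation, whose last coefficient can be
taken nonnegative. -/
theorem exists_affine_relation (v : Fin 4 → EuclideanSpace ℝ (Fin 2)) :
    ∃ w : Fin 4 → ℝ, ∑ i, w i = 0 ∧ ∑ i, w i • v i = 0 ∧ 0 ≤ w 3 ∧ w ≠ 0 := by
  have h : ¬ AffineIndependent ℝ v := fun h ↦ by
    have := h.card_le_finrank_succ.trans
      (Nat.add_le_add_right (Submodule.finrank_le _) 1)
    simp at this
  simp only [affineIndependent_iff_of_fintype, not_forall] at h
  obtain ⟨w, h0, hv, i, hi⟩ := h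
  rw [Finset.univ.weightedVSub_eq_linear_combination h0] at hv
  have hne : w ≠ 0 := fun h ↦ hi (by simp [h])
  rcases le_total 0 (w 3) with h3 | h3
  · exact ⟨w, h0, hv, h3, hne⟩
  · exact ⟨-w, by simp [h0], by simp [hv], by simpa using h3, by simpa using hne⟩

/-- A triangle in the plane is covered by the triangles that a further point spans with its
sides. -/
theorem mem_convexHull_triple_or_of_mem {P Q R T X : EuclideanSpace ℝ (Fin 2)}
    (hX : X ∈ convexHull ℝ {P, Q, R}) :
    X ∈ convexHull ℝ {P, Q, T} ∨ X ∈ convexHull ℝ {P, R, T} ∨ X ∈ convexHull ℝ {Q, R, T} := by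
  obtain ⟨a, b, c, ha, hb, hc, habc, rfl⟩ := mem_convexHull_triple_iff.1 hX
  obtain ⟨w, h0, hv, h3, hne⟩ := exists_affine_relation ![P, Q, R, T]
  have hneg : ∃ i : Fin 3, w i.castSucc < 0 := by
    by_contra! h
    refine hne ((Fintype.sum_eq_zero_iff_of_nonneg fun i ↦ ?_).1 h0)
    exact Fin.lastCases h3 h i
  obtain ⟨t, ht, hnn, j, hj⟩ := exists_nonneg_add_mul_and_eq_zero (a := ![a, b, c])
    (w := fun i : Fin 3 ↦ w i.castSucc) (by simp [Fin.forall_fin_succ, ha, hb, hc]) hneg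
  have hnP := hnn 0
  have hnQ := hnn 1
  have hnR := hnn 2
  simp only [Fin.sum_univ_four] at h0 hv
  simp at hnP hnQ hnR hv
  have key : a • P + b • Q + c • R = (a + t * w 0) • P + (b + t * w 1) • Q + (c + t * w 2) • R
      + (t * w 3) • T := by
    rw [← add_zero (a • P + b • Q + c • R), ← smul_zero t, ← hv]
    module
  have hsum : (a + t * w 0) + (b + t * w 1) + (c + t * w 2) + t * w 3 = 1 := by
    linear_combination habc + t * h0
  have h3' := mul_nonneg ht h3
  simp only [mem_convexHull_triple_iff, key]
  fin_cases j <;> simp at hj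
  · exact .inr (.inr ⟨_, _, _, hnQ, hnR, h3', by linarith, by simp [hj]⟩)
  · exact .inr (.inl ⟨_, _, _, hnP, hnR, h3', by linarith, by simp [hj]⟩)
  · exact .inl ⟨_, _, _, hnP, hnQ, h3', by linarith, by simp [hj]⟩

/-- The symmetric difference of the triangles `PQR` and `PQR'` is contained in
`conv{P,R,R'} ∪ conv{Q,R,R'}`. -/
theorem triangle_symmDiff_subset_union
    (P Q R R' : EuclideanSpace ℝ (Fin 2)) :
    symmDiff (convexHull ℝ {P, Q, R}) (convexHull ℝ {P, Q, R'}) ⊆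
      convexHull ℝ {P, R, R'} ∪ convexHull ℝ {Q, R, R'} := by
  rintro X (⟨h, h'⟩ | ⟨h, h'⟩)
  · exact (mem_convexHull_triple_or_of_mem h).resolve_left h'
  · rw [Set.pair_comm R R']
    exact (mem_convexHull_triple_or_of_mem h).resolve_left h'
end

section
/- Let P, Q, R, R' be points in the Euclidean plane ℝ². Then the Lebesgue measure (area) of the symmetric difference of the closed triangles conv{P,Q,R} and conv{P,Q,R'} is at most (1/2)·(dist(P,R) + dist(Q,R))·dist(R,R'). -/
open MeasureTheory Metric

theorem mem_convexHull_triple {E : Type*} [AddCommGroup E] [Module ℝ E] {A B C x : E} :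
    x ∈ convexHull ℝ {A, B, C} ↔
      ∃ a b c : ℝ, 0 ≤ a ∧ 0 ≤ b ∧ 0 ≤ c ∧ a + b + c = 1 ∧ a • A + b • B + c • C = x := by
  constructor
  · rw [convexHull_insert (Set.insert_nonempty _ _), convexHull_pair, convexJoin_singleton_left]
    simp only [Set.mem_iUnion]
    rintro ⟨y, ⟨u, v, hu, hv, huv, rfl⟩, s, t, hs, ht, hst, rfl⟩
    refine ⟨s, t * u, t * v, hs, mul_nonneg ht hu, mul_nonneg ht hv, ?_, ?_⟩
    · rw [add_assoc, ← mul_add, huv, mul_one, hst]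
    · module
  · rintro ⟨a, b, c, ha, hb, hc, h, rfl⟩
    refine mem_convexHull_of_exists_fintype ![a, b, c] ![A, B, C] ?_ ?_ ?_ ?_
    · simp [Fin.forall_fin_succ, ha, hb, hc]
    · simpa [Fin.sum_univ_succ, add_assoc] using h
    · simp [Fin.forall_fin_succ]
    · simp [Fin.sum_univ_succ, add_assoc]

/-- Moving a point of the nonnegative orthant in a direction with a negative coordinate, one
reaches the boundary of the orthant. -/
theorem exists_add_mul_nonneg_of_exists_neg {ι : Type*} [Fintype ι] (a d : ι → ℝ)
    (ha : ∀ i, 0 ≤ a i) (hd : ∃ i, d i < 0) :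
    ∃ t : ℝ, 0 ≤ t ∧ (∀ i, 0 ≤ a i + t * d i) ∧ ∃ i, a i + t * d i = 0 := by
  classical
  obtain ⟨j, hj⟩ := hd
  obtain ⟨i, hi, hmin⟩ := Finset.exists_min_image (Finset.univ.filter fun i => d i < 0)
    (fun i => a i / (-d i)) ⟨j, by simpa using hj⟩
  have hi : d i < 0 := by simpa using hi
  have ht : 0 ≤ a i / (-d i) := div_nonneg (ha i) (by linarith)
  refine ⟨a i / (-d i), ht, fun k => ?_, i, ?_⟩
  · by_cases hk : d k < 0
    · have := (le_div_iff₀ (by linarith : 0 < -d k)).1 (hmin k (by simpa using hk))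
      linarith
    · have := mul_nonneg ht (not_lt.1 hk)
      linarith [ha k]
  · have : d i ≠ 0 := hi.ne
    field_simp
    ring

theorem exists_affine_relation_s2 {E : Type*} [AddCommGroup E] [Module ℝ E] [FiniteDimensional ℝ E]
    (hE : Module.finrank ℝ E = 2) (v : Fin 4 → E) :
    ∃ g : Fin 4 → ℝ, ∑ i, g i • v i = 0 ∧ ∑ i, g i = 0 ∧ 0 ≤ g 3 ∧ ∃ i, g i ≠ 0 := by
  have h : ¬ LinearIndependent ℝ (fun i => (v i, (1 : ℝ))) := by
    intro h
    have := h.fintype_card_le_finrank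
    simp [Module.finrank_prod, hE] at this
  obtain ⟨g, hg, hne⟩ := Fintype.not_linearIndependent_iff.1 h
  have h1 : ∑ i, g i • v i = 0 := by simpa [Prod.fst_sum] using congrArg Prod.fst hg
  have h2 : ∑ i, g i = 0 := by simpa [Prod.snd_sum] using congrArg Prod.snd hg
  rcases le_total 0 (g 3) with h3 | h3
  · exact ⟨g, h1, h2, h3, hne⟩
  · exact ⟨fun i => -g i, by simp [h1], by simp [h2], by simpa using h3, by simpa using hne⟩

theorem convexHull_triple_diff_subset {E : Type*} [AddCommGroup E] [Module ℝ E]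
    [FiniteDimensional ℝ E] (hE : Module.finrank ℝ E = 2) (P Q R R' : E) :
    convexHull ℝ {P, Q, R} \ convexHull ℝ {P, Q, R'} ⊆
      convexHull ℝ {R, P, R'} ∪ convexHull ℝ {R, Q, R'} := by
  rintro x ⟨hx, hx'⟩
  obtain ⟨a, b, c, ha, hb, hc, habc, rfl⟩ := mem_convexHull_triple.1 hx
  obtain ⟨g, hg, hsum, h3, hne⟩ := exists_affine_relation_s2 hE ![P, Q, R, R']
  simp only [Fin.sum_univ_four, Matrix.cons_val] at hg hsum
  have hneg : ∃ i, ![g 0, g 1, g 2] i < 0 := by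
    by_contra! hcon
    simp only [Fin.forall_fin_succ, Matrix.cons_val_zero, Matrix.cons_val_succ] at hcon
    obtain ⟨h0, h1, h2, -⟩ := hcon
    obtain ⟨i, hi⟩ := hne
    apply hi
    fin_cases i <;> simp <;> linarith
  obtain ⟨t, ht, hall, i, hi⟩ := exists_add_mul_nonneg_of_exists_neg ![a, b, c]
    ![g 0, g 1, g 2] (by simp [Fin.forall_fin_succ, ha, hb, hc]) hneg
  have h0 : 0 ≤ a + t * g 0 := hall 0
  have h1 : 0 ≤ b + t * g 1 := hall 1
  have h2 : 0 ≤ c + t * g 2 := hall 2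
  have h3' : 0 ≤ t * g 3 := mul_nonneg ht h3
  have hs : (a + t * g 0) + (b + t * g 1) + (c + t * g 2) + t * g 3 = 1 := by
    linear_combination habc + t * hsum
  have hx : (a + t * g 0) • P + (b + t * g 1) • Q + (c + t * g 2) • R + (t * g 3) • R' =
      a • P + b • Q + c • R := by
    trans a • P + b • Q + c • R + t • (g 0 • P + g 1 • Q + g 2 • R + g 3 • R')
    · module
    · rw [hg, smul_zero, add_zero]
  rw [← hx] at hx' ⊢
  fin_cases i
  · have hi : a + t * g 0 = 0 := hi
    refine Or.inr (mem_convexHull_triple.2 ⟨_, _, _, h2, h1, h3', by linarith, ?_⟩)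
    rw [hi]; module
  · have hi : b + t * g 1 = 0 := hi
    refine Or.inl (mem_convexHull_triple.2 ⟨_, _, _, h2, h0, h3', by linarith, ?_⟩)
    rw [hi]; module
  · have hi : c + t * g 2 = 0 := hi
    refine (hx' (mem_convexHull_triple.2 ⟨_, _, _, h0, h1, h3', by linarith, ?_⟩)).elim
    rw [hi]; module

theorem volume_prod_standard_triangle_le :
    volume {p : ℝ × ℝ | 0 ≤ p.1 ∧ 0 ≤ p.2 ∧ p.1 + p.2 ≤ 1} ≤ ENNReal.ofReal (1 / 2) := by
  have hmeas : MeasurableSet {p : ℝ × ℝ | 0 ≤ p.1 ∧ 0 ≤ p.2 ∧ p.1 + p.2 ≤ 1} := by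
    measurability
  rw [Measure.volume_eq_prod, Measure.prod_apply hmeas]
  calc ∫⁻ x : ℝ, volume (Prod.mk x ⁻¹' {p : ℝ × ℝ | 0 ≤ p.1 ∧ 0 ≤ p.2 ∧ p.1 + p.2 ≤ 1})
      ≤ ∫⁻ x : ℝ, (Set.Icc (0 : ℝ) 1).indicator (fun x => ENNReal.ofReal (1 - x)) x := by
        refine lintegral_mono fun x => ?_
        by_cases hx : x ∈ Set.Icc (0 : ℝ) 1
        · rw [Set.indicator_of_mem hx]
          refine (measure_mono (t := Set.Icc 0 (1 - x)) ?_).trans (by simp)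
          rintro y ⟨-, h2, h3⟩
          exact ⟨h2, by linarith [show x + y ≤ 1 from h3]⟩
        · rw [Set.indicator_of_notMem hx, nonpos_iff_eq_zero]
          convert measure_empty (μ := (volume : Measure ℝ))
          refine Set.eq_empty_of_forall_notMem ?_
          rintro y ⟨h1, h2, h3⟩
          exact hx ⟨h1, by linarith [show x + y ≤ 1 from h3, show 0 ≤ y from h2]⟩
    _ = ENNReal.ofReal (∫ x in Set.Icc (0 : ℝ) 1, (1 - x)) := by
        rw [lintegral_indicator measurableSet_Icc, ofReal_integral_eq_lintegral_ofReal]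
        · exact (by fun_prop : Continuous fun x : ℝ => 1 - x).integrableOn_Icc
        · filter_upwards [ae_restrict_mem measurableSet_Icc] with x hx
          simpa using hx.2
    _ = ENNReal.ofReal (1 / 2) := by
        rw [integral_Icc_eq_integral_Ioc, ← intervalIntegral.integral_of_le zero_le_one]
        rw [intervalIntegral.integral_sub (by simp) (by simp)]
        norm_num

theorem volume_pi_standard_triangle_le :
    volume {p : Fin 2 → ℝ | 0 ≤ p 0 ∧ 0 ≤ p 1 ∧ p 0 + p 1 ≤ 1} ≤ ENNReal.ofReal (1 / 2) := by
  refine le_of_eq_of_le ?_ volume_prod_standard_triangle_le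
  exact (volume_preserving_finTwoArrow ℝ).measure_preimage_equiv
    {p : ℝ × ℝ | 0 ≤ p.1 ∧ 0 ≤ p.2 ∧ p.1 + p.2 ≤ 1}

theorem volume_convexHull_triple_le_det (A B C : EuclideanSpace ℝ (Fin 2)) :
    volume (convexHull ℝ {A, B, C}) ≤
      ENNReal.ofReal (1 / 2 * |(B 0 - A 0) * (C 1 - A 1) - (C 0 - A 0) * (B 1 - A 1)|) := by
  set M : Matrix (Fin 2) (Fin 2) ℝ := !![B 0 - A 0, C 0 - A 0; B 1 - A 1, C 1 - A 1] with hM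
  set S : Set (Fin 2 → ℝ) := {p | 0 ≤ p 0 ∧ 0 ≤ p 1 ∧ p 0 + p 1 ≤ 1} with hS
  have hsub : convexHull ℝ {A, B, C} ⊆
      (MeasurableEquiv.toLp 2 (Fin 2 → ℝ)).symm ⁻¹'
        ((fun p => A.ofLp + p) '' (Matrix.toLin' M '' S)) := by
    intro x hx
    obtain ⟨a, b, c, ha, hb, hc, habc, rfl⟩ := mem_convexHull_triple.1 hx
    refine ⟨_, ⟨![b, c], ⟨hb, hc, ?_⟩, rfl⟩, ?_⟩
    · simp only [Matrix.cons_val]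
      linarith
    · obtain rfl : a = 1 - b - c := by linarith
      ext i
      fin_cases i <;> simp [hM] <;> ring
  calc volume (convexHull ℝ {A, B, C})
      ≤ volume ((fun p => A.ofLp + p) '' (Matrix.toLin' M '' S)) := by
        refine (measure_mono hsub).trans_eq ?_
        exact (EuclideanSpace.volume_preserving_symm_measurableEquiv_toLp
          (Fin 2)).measure_preimage_equiv _
    _ = ENNReal.ofReal |M.det| * volume S := by
        rw [Set.image_add_left, measure_preimage_add, Measure.addHaar_image_linearMap,
          LinearMap.det_toLin']
    _ ≤ ENNReal.ofReal |M.det| * ENNReal.ofReal (1 / 2) := by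
        gcongr
        exact volume_pi_standard_triangle_le
    _ = _ := by
        rw [← ENNReal.ofReal_mul (abs_nonneg _), mul_comm, hM, Matrix.det_fin_two_of]

theorem volume_convexHull_triple_le (A B C : EuclideanSpace ℝ (Fin 2)) :
    volume (convexHull ℝ {A, B, C}) ≤ ENNReal.ofReal (1 / 2 * (dist B A * dist A C)) := by
  refine (volume_convexHull_triple_le_det A B C).trans (ENNReal.ofReal_le_ofReal ?_)
  gcongr
  refine abs_le_of_sq_le_sq ?_ (by positivity)
  rw [mul_pow, EuclideanSpace.dist_sq_eq, EuclideanSpace.dist_sq_eq]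
  simp only [Fin.sum_univ_two, Real.dist_eq, sq_abs]
  nlinarith [sq_nonneg ((B 0 - A 0) * (C 0 - A 0) + (B 1 - A 1) * (C 1 - A 1))]

/-- The area of the symmetric difference of the triangles `PQR` and `PQR'` is at most
`(1/2) * (dist P R + dist Q R) * dist R R'`. -/
theorem triangle_symmDiff_area_le
    (P Q R R' : EuclideanSpace ℝ (Fin 2)) :
    volume (symmDiff (convexHull ℝ {P, Q, R}) (convexHull ℝ {P, Q, R'})) ≤
      ENNReal.ofReal ((1 / 2) * (dist P R + dist Q R) * dist R R') := by
  have hE : Module.finrank ℝ (EuclideanSpace ℝ (Fin 2)) = 2 := by simp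
  have hswap (X : EuclideanSpace ℝ (Fin 2)) :
      ({R', X, R} : Set (EuclideanSpace ℝ (Fin 2))) = {R, X, R'} := by
    ext; simp; tauto
  have hsub : symmDiff (convexHull ℝ {P, Q, R}) (convexHull ℝ {P, Q, R'}) ⊆
      convexHull ℝ {R, P, R'} ∪ convexHull ℝ {R, Q, R'} := by
    refine Set.union_subset (convexHull_triple_diff_subset hE P Q R R') ?_
    have := convexHull_triple_diff_subset hE P Q R' R
    rwa [hswap, hswap] at this
  calc volume (symmDiff (convexHull ℝ {P, Q, R}) (convexHull ℝ {P, Q, R'}))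
      ≤ volume (convexHull ℝ {R, P, R'}) + volume (convexHull ℝ {R, Q, R'}) :=
        (measure_mono hsub).trans (measure_union_le _ _)
    _ ≤ ENNReal.ofReal (1 / 2 * (dist P R * dist R R')) +
          ENNReal.ofReal (1 / 2 * (dist Q R * dist R R')) :=
        add_le_add (volume_convexHull_triple_le R P R') (volume_convexHull_triple_le R Q R')
    _ = ENNReal.ofReal ((1 / 2) * (dist P R + dist Q R) * dist R R') := by
        rw [← ENNReal.ofReal_add (by positivity) (by positivity)]
        congr 1
        ring
end
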